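/- Let C be a k-linear abelian rigid tensor category and D a k-linear abelian tensor category, and let F : C → D be an exact tensor functor. Suppose there exists a family A of objects of C such that: (a) the unit object of C belongs to A; (b) for all V, W ∈ A the map F : Hom_C(V, W) → Hom_D(F(V), F(W)) is bijective; and (c) every object V of C admits a monomorphism V ↪ W into some object W ∈ A. Then F is fully faithful. -/

import Mathlib

/-!
# Statement 19

Let `C` be a `k`-linear abelian rigid tensor category and `D` a `k`-linear abelian
tensor category, and let `F : C → D` be an exact tensor functor. Suppose there exists
a family `A` of objects of `C` such that: (a) the unit object of `C` belongs to `A`;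
(b) for all `V, W ∈ A` the map `F : Hom_C(V, W) → Hom_D(F V, F W)` is bijective; and
(c) every object `V` of `C` admits a monomorphism `V ↪ W` into some object `W ∈ A`.
Then `F` is fully faithful.

In Mathlib terms: a `k`-linear abelian (rigid) tensor category is a `k`-linear abelian
category with a (symmetric, which is not needed for the statement) monoidal structure
(`MonoidalCategory`), rigidity meaning every object has both duals (`RigidCategory`);
a tensor functor is a monoidal functor (`Functor.Monoidal`), and exactness is
preservation of finite limits and colimits.
-/

open CategoryTheory CategoryTheory.Limits MonoidalCategory

universe v u v' u'

namespace Statement19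

open Functor.LaxMonoidal Functor.OplaxMonoidal Functor.Monoidal in
lemma triangle_map {C : Type u} [Category.{v} C] [MonoidalCategory C]
    {D : Type u'} [Category.{v'} D] [MonoidalCategory D] (F : C ⥤ D) [F.Monoidal]
    (V V' W : C) [ExactPairing V V'] (φ : F.obj V ⟶ F.obj W) :
    F.map (λ_ V).inv ≫ δ F _ _ ≫
      (F.map (ExactPairing.coevaluation V V') ≫ δ F _ _ ≫ φ ▷ F.obj V' ≫ μ F _ _) ▷ F.obj V ≫
      μ F _ _ ≫ F.map (α_ W V' V).hom ≫ F.map (W ◁ ExactPairing.evaluation V V') ≫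
      F.map (ρ_ W).hom = φ := by
  have tri := congrArg F.map (ExactPairing.evaluation_coevaluation V V')
  have h1 : F.map (ExactPairing.coevaluation V V') ▷ F.obj V ≫ δ F V V' ▷ F.obj V ≫
      (α_ _ _ _).hom ≫ F.obj V ◁ (μ F V' V ≫ F.map (ExactPairing.evaluation V V')) =
      μ F _ _ ≫ F.map ((λ_ V).hom ≫ (ρ_ V).inv) ≫ δ F _ _ := by
    rw [← tri]
    simp only [Functor.map_comp, map_whiskerRight, map_associator, map_whiskerLeft,
      Category.assoc, MonoidalCategory.whiskerLeft_comp, μ_δ_assoc, μ_δ, Category.comp_id]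
  have h2 : μ F W V' ▷ F.obj V ≫ μ F _ _ ≫ F.map (α_ W V' V).hom ≫
      F.map (W ◁ ExactPairing.evaluation V V') = (α_ _ _ _).hom ≫
      F.obj W ◁ (μ F V' V ≫ F.map (ExactPairing.evaluation V V')) ≫ μ F _ _ := by
    simp only [map_associator, map_whiskerLeft, Category.assoc,
      MonoidalCategory.whiskerLeft_comp, μ_δ_assoc, whiskerRight_μ_δ_assoc]
  have h3 : φ ▷ F.obj (𝟙_ C) ≫ μ F _ _ ≫ F.map (ρ_ W).hom =
      μ F _ _ ≫ F.map (ρ_ V).hom ≫ φ := by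
    simp only [map_rightUnitor, μ_δ_assoc, Category.assoc, ← rightUnitor_naturality,
      whisker_exchange_assoc]
  simp only [comp_whiskerRight, Category.assoc]
  rw [reassoc_of% h2, associator_naturality_left_assoc, ← whisker_exchange_assoc, h3,
    reassoc_of% h1]
  simp [← Functor.map_comp_assoc]

open Functor.LaxMonoidal Functor.OplaxMonoidal Functor.Monoidal in
lemma ff_of_unit {C : Type u} [Category.{v} C] [MonoidalCategory C] [RigidCategory C]
    {D : Type u'} [Category.{v'} D] [MonoidalCategory D] (F : C ⥤ D) [F.Monoidal]
    (h : ∀ X : C, Function.Bijective (fun f : 𝟙_ C ⟶ X => F.map f)) : F.Full ∧ F.Faithful := by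
  refine ⟨⟨fun {V W} φ => ?_⟩, ⟨fun {V W} f g hfg => ?_⟩⟩
  · obtain ⟨a, ha⟩ := (h (W ⊗ Vᘁ)).2 (F.map (ExactPairing.coevaluation V Vᘁ) ≫
      δ F _ _ ≫ φ ▷ F.obj Vᘁ ≫ μ F _ _)
    refine ⟨(λ_ V).inv ≫ a ▷ V ≫ (α_ _ _ _).hom ≫ W ◁ ExactPairing.evaluation V Vᘁ ≫
      (ρ_ W).hom, ?_⟩
    dsimp only at ha
    rw [← triangle_map F V Vᘁ W φ, ← ha]
    simp only [Functor.map_comp, map_whiskerRight, Category.assoc]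
  · have e : ExactPairing.coevaluation V Vᘁ ≫ f ▷ Vᘁ =
        ExactPairing.coevaluation V Vᘁ ≫ g ▷ Vᘁ := by
      apply (h _).1
      simp only [Functor.map_comp, map_whiskerRight, hfg]
    have := congrArg (tensorRightHomEquiv _ V Vᘁ _).symm e
    simpa [tensorRightHomEquiv_symm_coevaluation_comp_whiskerRight] using this

lemma unit_bij {C : Type u} [Category.{v} C] [Abelian C]
    {D : Type u'} [Category.{v'} D] [Abelian D]
    (F : C ⥤ D) [PreservesFiniteLimits F]
    (A : Set C) (U : C) (ha : U ∈ A)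
    (hb : ∀ V W : C, V ∈ A → W ∈ A → Function.Bijective (fun f : V ⟶ W => F.map f))
    (hc : ∀ V : C, ∃ W ∈ A, ∃ i : V ⟶ W, Mono i) (X : C) :
    Function.Bijective (fun f : U ⟶ X => F.map f) := by
  obtain ⟨W, hW, i, hi⟩ := hc X
  obtain ⟨W', hW', j, hj⟩ := hc (cokernel i)
  refine ⟨fun f g hfg => ?_, fun φ => ?_⟩
  · dsimp only at hfg
    rw [← cancel_mono i]
    apply (hb _ _ ha hW).1
    simp only [Functor.map_comp, hfg]
  · obtain ⟨b, hbb⟩ := (hb _ _ ha hW).2 (φ ≫ F.map i)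
    dsimp only at hbb
    have hz : b ≫ cokernel.π i ≫ j = 0 ≫ cokernel.π i ≫ j := by
      apply (hb _ _ ha hW').1
      have : F.map (i ≫ cokernel.π i ≫ j) = F.map (0 ≫ cokernel.π i ≫ j) := by simp
      have h0 : F.map (0 : X ⟶ W') = 0 := F.map_zero _ _
      have h0' : F.map (0 : U ⟶ W') = 0 := F.map_zero _ _
      simp only [Functor.map_comp, hbb, Category.assoc, zero_comp, h0']
      simp only [← Functor.map_comp, cokernel.condition_assoc, zero_comp, h0, comp_zero]
    have hz' : b ≫ cokernel.π i = 0 := by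
      rw [← cancel_mono j]; simpa using hz
    refine ⟨Abelian.monoLift i b hz', ?_⟩
    dsimp only
    rw [← cancel_mono (F.map i), ← Functor.map_comp, Abelian.monoLift_comp, hbb]


/-- An exact tensor functor `F : C → D` from a `k`-linear abelian
rigid tensor category to a `k`-linear abelian tensor category which is bijective on
morphisms between members of a family `A` containing the unit object and receiving a
monomorphism from every object of `C` is fully faithful. -/
theorem exact_tensor_functor_fully_faithful
    (k : Type) [Field k]
    -- `C` is a `k`-linear abelian rigid tensor category:
    (C : Type u) [Category.{v} C] [Abelian C] [Linear k C] [MonoidalCategory C]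
    [RigidCategory C]
    -- `D` is a `k`-linear abelian tensor category:
    (D : Type u') [Category.{v'} D] [Abelian D] [Linear k D] [MonoidalCategory D]
    -- `F : C → D` is an exact tensor functor:
    (F : C ⥤ D) [F.Monoidal] [PreservesFiniteLimits F] [PreservesFiniteColimits F]
    -- the family `A` of objects of `C`:
    (A : Set C)
    -- (a) the unit object belongs to `A`:
    (ha : (𝟙_ C) ∈ A)
    -- (b) `F` is bijective on morphisms between members of `A`:
    (hb : ∀ V W : C, V ∈ A → W ∈ A → Function.Bijective (fun f : V ⟶ W => F.map f))
    -- (c) every object embeds into a member of `A`: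
    (hc : ∀ V : C, ∃ W ∈ A, ∃ i : V ⟶ W, Mono i) :
    F.Full ∧ F.Faithful := by
  exact ff_of_unit F (unit_bij F A _ ha hb hc)

end Statement19
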